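/- Fix n, m ≥ 1 with A = {a_1,…,a_n}. For each ℓ, let G = ⟨A ∣ R⟩_M where R consists of m independent random relators of length ℓ. Then asymptotically almost surely as ℓ → ∞, there exist finitely generated subgroups H and K of G such that: (1) H is a free metabelian group of rank max(n − m, 0); (2) K is generated by m elements, K is virtually abelian, and its normal closure L = K^G in G is virtually abelian; (3) G is generated by H together with K, and G = L·H. -/

import Mathlib

instance derivedSeriesNormal {G : Type*} [Group G] (k : ℕ) : (derivedSeries G k).Normal :=
  derivedSeries_normal G k

/-- The normal subgroup `N · F''` of the free group determined by the relators `R`,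
where `N` is the normal closure of `R` and `F''` is the second derived subgroup. -/
def metabelianRel {n : ℕ} (R : Set (FreeGroup (Fin n))) : Subgroup (FreeGroup (Fin n)) :=
  Subgroup.normalClosure (R ∪ (derivedSeries (FreeGroup (Fin n)) 2 : Subgroup (FreeGroup (Fin n))))

instance {n : ℕ} (R : Set (FreeGroup (Fin n))) : (metabelianRel R).Normal :=
  Subgroup.normalClosure_normal

/-- The metabelian group presented by `⟨A ∣ R⟩_M`, i.e. `F(A)/(N·F(A)'')`. -/
abbrev MetabelianPresented {n : ℕ} (R : Set (FreeGroup (Fin n))) : Type :=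
  FreeGroup (Fin n) ⧸ metabelianRel R

/-- A group is virtually abelian if it has an abelian subgroup of finite index. -/
def VirtuallyAbelian (G : Type*) [Group G] : Prop :=
  ∃ H : Subgroup G, (∀ x ∈ H, ∀ y ∈ H, x * y = y * x) ∧ H.FiniteIndex

/-- The metabelian group presented by the `m` relators of length `ℓ` encoded by `w`:
each letter of a word is a generator index in `Fin n` together with a sign (`true` for the
generator, `false` for its inverse), and the word is read off as an element of the free
group by concatenating its letters. -/
abbrev RandomMetabelian {n m ℓ : ℕ} (w : Fin m → Fin ℓ → Fin n × Bool) : Type :=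
  MetabelianPresented (Set.range fun i => FreeGroup.mk (List.ofFn (w i)))

/-- The free metabelian group of rank `k`. -/
abbrev FreeMetabelian (k : ℕ) : Type :=
  FreeGroup (Fin k) ⧸ derivedSeries (FreeGroup (Fin k)) 2


/-! ### Exponent sums -/

/-- Exponent-sum homomorphism. -/
def exHom (n : ℕ) : FreeGroup (Fin n) →* Multiplicative (Fin n → ℤ) :=
  FreeGroup.lift fun i => Multiplicative.ofAdd (Pi.single i 1)

/-- Exponent-sum vector. -/
def ex {n : ℕ} (g : FreeGroup (Fin n)) : Fin n → ℤ := Multiplicative.toAdd (exHom n g)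

@[simp] lemma ex_one {n : ℕ} : ex (1 : FreeGroup (Fin n)) = 0 := by simp [ex]
@[simp] lemma ex_mul {n : ℕ} (g h : FreeGroup (Fin n)) : ex (g * h) = ex g + ex h := by simp [ex]
@[simp] lemma ex_inv {n : ℕ} (g : FreeGroup (Fin n)) : ex (g⁻¹) = - ex g := by simp [ex]
@[simp] lemma ex_zpow {n : ℕ} (g : FreeGroup (Fin n)) (k : ℤ) : ex (g ^ k) = k • ex g := by
  simp [ex]
@[simp] lemma ex_of {n : ℕ} (i : Fin n) : ex (FreeGroup.of i) = Pi.single i 1 := by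
  simp [ex, exHom]

/-- The homomorphism from `ℤⁿ` with prescribed values on the basis. -/
def vecHom {n : ℕ} {Q : Type*} [CommGroup Q] (x : Fin n → Q) : Multiplicative (Fin n → ℤ) →* Q where
  toFun v := ∏ i, x i ^ (Multiplicative.toAdd v i)
  map_one' := by simp
  map_mul' u v := by simp [zpow_add, Finset.prod_mul_distrib]

lemma vecHom_exHom {n : ℕ} {Q : Type*} [CommGroup Q] (f : FreeGroup (Fin n) →* Q) :
    (vecHom fun i => f (FreeGroup.of i)).comp (exHom n) = f := by
  ext i
  simp only [MonoidHom.comp_apply, vecHom, exHom, FreeGroup.lift_apply_of, MonoidHom.coe_mk,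
    OneHom.coe_mk, toAdd_ofAdd]
  rw [Finset.prod_eq_single i]
  · simp
  · intro j _ hj
    simp [hj]
  · simp

lemma hom_eq_vecHom {n : ℕ} {Q : Type*} [CommGroup Q] (f : FreeGroup (Fin n) →* Q)
    (g : FreeGroup (Fin n)) :
    f g = vecHom (fun i => f (FreeGroup.of i)) (Multiplicative.ofAdd (ex g)) := by
  conv_lhs => rw [← vecHom_exHom f]
  rfl

lemma hom_eq_one_of_ex {n : ℕ} {Q : Type*} [CommGroup Q] (f : FreeGroup (Fin n) →* Q)
    {g : FreeGroup (Fin n)} (h : ex g = 0) : f g = 1 := by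
  rw [hom_eq_vecHom, h]; simp

lemma mem_commutator_of_ex {n : ℕ} {g : FreeGroup (Fin n)} (h : ex g = 0) :
    g ∈ commutator (FreeGroup (Fin n)) := by
  rw [← Abelianization.ker_of]
  exact hom_eq_one_of_ex _ h

lemma ex_surj {n : ℕ} : Function.Surjective (ex (n := n)) := by
  intro v
  have : ∀ s : Finset (Fin n), ∃ g : FreeGroup (Fin n), ex g = ∑ i ∈ s, Pi.single i (v i) := by
    intro s
    induction s using Finset.induction_on with
    | empty => exact ⟨1, by simp⟩
    | insert a s ha ih =>
      obtain ⟨g, hg⟩ := ih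
      refine ⟨FreeGroup.of a ^ v a * g, ?_⟩
      rw [ex_mul, hg, Finset.sum_insert ha, ex_zpow, ex_of, ← Pi.single_smul]; simp
  obtain ⟨g, hg⟩ := this Finset.univ
  exact ⟨g, by rw [hg, Finset.univ_sum_single]⟩

/-! ### The Magnus representation -/

/-- The group ring of `ℤ^d`. -/
abbrev LR (d : ℕ) : Type := AddMonoidAlgebra ℤ (Fin d → ℤ)

/-- The monomial. -/
noncomputable def mono {d : ℕ} (a : Fin d → ℤ) : LR d := AddMonoidAlgebra.single a 1

lemma mono_add {d : ℕ} (a b : Fin d → ℤ) : mono (a + b) = mono a * mono b := by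
  simp [mono, AddMonoidAlgebra.single_mul_single]
@[simp] lemma mono_zero {d : ℕ} : mono (0 : Fin d → ℤ) = 1 := rfl

/-- The Magnus group `ℤ[ℤ^d]^n ⋊ ℤ^d`. -/
@[ext] structure Mag (d n : ℕ) where
  /-- torus part -/
  a : Fin d → ℤ
  /-- module part -/
  v : Fin n → LR d

namespace Mag
variable {d n : ℕ}
noncomputable instance : Mul (Mag d n) := ⟨fun x y => ⟨x.a + y.a, x.v + mono x.a • y.v⟩⟩
noncomputable instance : One (Mag d n) := ⟨⟨0, 0⟩⟩
noncomputable instance : Inv (Mag d n) := ⟨fun x => ⟨-x.a, -(mono (-x.a) • x.v)⟩⟩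
@[simp] lemma mul_a (x y : Mag d n) : (x * y).a = x.a + y.a := rfl
@[simp] lemma mul_v (x y : Mag d n) : (x * y).v = x.v + mono x.a • y.v := rfl
@[simp] lemma one_a : (1 : Mag d n).a = 0 := rfl
@[simp] lemma one_v : (1 : Mag d n).v = 0 := rfl
@[simp] lemma inv_a (x : Mag d n) : (x⁻¹).a = -x.a := rfl
@[simp] lemma inv_v (x : Mag d n) : (x⁻¹).v = -(mono (-x.a) • x.v) := rfl

noncomputable instance : Group (Mag d n) := Group.ofLeftAxioms
  (fun x y z => by
    ext1
    · simp [add_assoc]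
    · simp [mono_add, mul_smul, add_assoc])
  (fun x => by ext1 <;> simp)
  (fun x => by ext1 <;> simp)

/-- torus projection -/
noncomputable def proj : Mag d n →* Multiplicative (Fin d → ℤ) where
  toFun x := Multiplicative.ofAdd x.a
  map_one' := rfl
  map_mul' _ _ := rfl

lemma a_of_mem_commutator {x : Mag d n} (h : x ∈ commutator (Mag d n)) : x.a = 0 :=
  Abelianization.commutator_subset_ker proj h

lemma derived_two : derivedSeries (Mag d n) 2 = ⊥ := by
  rw [derivedSeries_succ, derivedSeries_one, Subgroup.commutator_eq_bot_iff_le_centralizer]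
  intro x hx
  rw [Subgroup.mem_centralizer_iff]
  intro y hy
  have h1 := a_of_mem_commutator hx
  have h2 := a_of_mem_commutator hy
  ext1
  · simp [h1, h2]
  · simp [h1, h2, add_comm]
end Mag

/-- The Magnus homomorphism with torus weights `τ`. -/
noncomputable def mag {d n : ℕ} (τ : Fin n → Fin d → ℤ) : FreeGroup (Fin n) →* Mag d n :=
  FreeGroup.lift fun i => ⟨τ i, Pi.single i 1⟩

@[simp] lemma mag_of {d n : ℕ} (τ : Fin n → Fin d → ℤ) (i : Fin n) :
    mag τ (FreeGroup.of i) = ⟨τ i, Pi.single i 1⟩ := by simp [mag]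

lemma mag_a {d n : ℕ} (τ : Fin n → Fin d → ℤ) (g : FreeGroup (Fin n)) :
    (mag τ g).a = ∑ i, ex g i • τ i := by
  have := hom_eq_vecHom (Mag.proj.comp (mag τ)) g
  have h := congrArg Multiplicative.toAdd this
  simp only [MonoidHom.comp_apply, mag_of, vecHom, MonoidHom.coe_mk, OneHom.coe_mk,
    toAdd_ofAdd] at h
  rw [toAdd_prod] at h
  exact h

lemma mag_a_id {n : ℕ} (g : FreeGroup (Fin n)) :
    (mag (fun i => Pi.single i 1) g).a = ex g := by
  rw [mag_a]
  conv_rhs => rw [← Finset.univ_sum_single (ex g)]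
  refine Finset.sum_congr rfl fun i _ => ?_
  rw [← Pi.single_smul]; simp

lemma freeGroup_right_induction {n : ℕ} {p : FreeGroup (Fin n) → Prop} (one : p 1)
    (h1 : ∀ g i, p g → p (g * FreeGroup.of i)) (h2 : ∀ g i, p g → p (g * (FreeGroup.of i)⁻¹))
    (g : FreeGroup (Fin n)) : p g := by
  have hg : g ∈ Subgroup.closure (Set.range (FreeGroup.of (α := Fin n))) := by
    rw [FreeGroup.closure_range_of]; trivial
  refine Subgroup.closure_induction_right (p := fun x _ => p x) one ?_ ?_ hg
  · rintro x _ _ ⟨i, rfl⟩ hx; exact h1 _ _ hx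
  · rintro x _ _ ⟨i, rfl⟩ hx; exact h2 _ _ hx

/-- Magnus embedding: an element with trivial Magnus image lies in `F''`. -/
theorem magnus_kernel {n : ℕ} (g : FreeGroup (Fin n))
    (hg : (mag (fun i => Pi.single i 1 : Fin n → Fin n → ℤ) g).v = 0) (hg0 : ex g = 0) :
    g ∈ derivedSeries (FreeGroup (Fin n)) 2 := by
  set M := mag (fun i => Pi.single i 1 : Fin n → Fin n → ℤ) with hM
  obtain ⟨s, hs⟩ := (ex_surj (n := n)).hasRightInverse
  let F' := commutator (FreeGroup (Fin n))
  let κ : FreeGroup (Fin n) → F' := fun h =>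
    ⟨h * (s (ex h))⁻¹, mem_commutator_of_ex (by simp [hs (ex h)])⟩
  have hκ : ∀ h k, κ (h * k) = κ h * κ (s (ex h) * k) := by
    intro h k
    apply Subtype.ext
    simp [κ, hs (ex h), mul_assoc]
  let q : FreeGroup (Fin n) → Additive (Abelianization F') := fun h =>
    Additive.ofMul (Abelianization.of (κ h))
  have hq : ∀ h k, q (h * k) = q h + q (s (ex h) * k) := by
    intro h k
    simp only [q]
    rw [hκ, map_mul, ofMul_mul]
  let ψ : Fin n → LR n →+ Additive (Abelianization F') := fun j =>
    (Finsupp.liftAddHom fun a : Fin n → ℤ =>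
      (zmultiplesHom _ (q (s a * FreeGroup.of j)))).comp
      (AddMonoidAlgebra.coeffAddEquiv).toAddMonoidHom
  have hψ : ∀ j a, ψ j (mono a) = q (s a * FreeGroup.of j) := by
    intro j a
    simp [ψ, mono]
  let Ψ : (Fin n → LR n) →+ Additive (Abelianization F') :=
    { toFun := fun v => ∑ j, ψ j (v j)
      map_zero' := by simp
      map_add' := by intro u v; simp [Finset.sum_add_distrib] }
  have hΨ : ∀ j a, Ψ (mono a • Pi.single j 1) = q (s a * FreeGroup.of j) := by
    intro j a
    change ∑ k, ψ k ((mono a • (Pi.single j 1 : Fin n → LR n)) k) = _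
    rw [Finset.sum_eq_single j]
    · simp [hψ]
    · intro k _ hk
      simp [hk]
    · simp
  have step : ∀ h j, q (h * FreeGroup.of j) - Ψ (M (h * FreeGroup.of j)).v = q h - Ψ (M h).v := by
    intro h j
    rw [hq, map_mul, Mag.mul_v, map_add, hM, mag_a_id, mag_of, hΨ]
    abel
  have key : ∀ h, q h - Ψ (M h).v = q 1 := by
    intro h
    induction h using freeGroup_right_induction with
    | one => simp
    | h1 g i ih => rw [step, ih]
    | h2 g i ih => rw [← step, inv_mul_cancel_right, ih]
  have h1 := key g
  rw [hg, map_zero, sub_zero] at h1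
  have h2 : Abelianization.of (κ g) = Abelianization.of (κ 1) := h1
  have h3 : (κ g) * (κ 1)⁻¹ ∈ commutator F' := by
    rw [← Abelianization.ker_of, MonoidHom.mem_ker, map_mul, h2, map_inv, mul_inv_cancel]
  rw [derivedSeries_succ, derivedSeries_one, ← Subgroup.map_subtype_commutator]
  refine ⟨_, h3, ?_⟩
  simp [κ, hg0]


/-! ### Freeness of `H` -/

/-- Augmentation. -/
noncomputable def aug (d : ℕ) : LR d →+* ℤ :=
  ((AddMonoidAlgebra.lift ℤ ℤ (Fin d → ℤ)) 1).toRingHom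

@[simp] lemma aug_mono {d : ℕ} (a : Fin d → ℤ) : aug d (mono a) = 1 := by
  simp [aug, mono]

lemma aug_mag {d n : ℕ} (τ : Fin n → Fin d → ℤ) (g : FreeGroup (Fin n)) (j : Fin n) :
    aug d ((mag τ g).v j) = ex g j := by
  have step : ∀ g i, aug d ((mag τ (g * FreeGroup.of i)).v j) - ex (g * FreeGroup.of i) j =
      aug d ((mag τ g).v j) - ex g j := by
    intro g i
    by_cases h : j = i
    · subst h; simp
    · simp [h]
  have : aug d ((mag τ g).v j) - ex g j = 0 := by
    induction g using freeGroup_right_induction with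
    | one => simp
    | h1 g i ih => rw [step, ih]
    | h2 g i ih => rw [← step, inv_mul_cancel_right, ih]
  linarith

/-- The torus weights: the first `m` generators are killed. -/
def wt (m d : ℕ) : Fin (m + d) → Fin d → ℤ :=
  Fin.addCases (fun _ => 0) (fun j => Pi.single j 1)

@[simp] lemma wt_natAdd {m d : ℕ} (j : Fin d) : wt m d (Fin.natAdd m j) = Pi.single j 1 := by
  simp [wt]
@[simp] lemma wt_castAdd {m d : ℕ} (j : Fin m) : wt m d (Fin.castAdd d j) = 0 := by
  simp [wt]

lemma mag_incl {m d : ℕ} (h : FreeGroup (Fin d)) :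
    (mag (wt m d) (FreeGroup.map (Fin.natAdd m) h)).a =
        (mag (fun i => Pi.single i 1 : Fin d → Fin d → ℤ) h).a ∧
    (∀ j, (mag (wt m d) (FreeGroup.map (Fin.natAdd m) h)).v (Fin.natAdd m j) =
        (mag (fun i => Pi.single i 1 : Fin d → Fin d → ℤ) h).v j) ∧
    (∀ j, (mag (wt m d) (FreeGroup.map (Fin.natAdd m) h)).v (Fin.castAdd d j) = 0) := by
  have e1 : ∀ (i j : Fin d) (R : Type) [Zero R] (x : R),
      (Pi.single (Fin.natAdd m i) x : Fin (m + d) → R) (Fin.natAdd m j) =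
      (Pi.single i x : Fin d → R) j := by
    intro i j R _ x
    by_cases hij : j = i
    · subst hij; simp
    · rw [Pi.single_eq_of_ne hij, Pi.single_eq_of_ne]
      simpa [Fin.ext_iff] using hij
  have e2 : ∀ (i : Fin d) (j : Fin m) (R : Type) [Zero R] (x : R),
      (Pi.single (Fin.natAdd m i) x : Fin (m + d) → R) (Fin.castAdd d j) = 0 := by
    intro i j R _ x
    rw [Pi.single_eq_of_ne]
    have := j.2
    simp [Fin.ext_iff]; omega
  induction h using freeGroup_right_induction with
  | one => simp
  | h1 g i ih =>
    obtain ⟨h1, h2, h3⟩ := ih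
    refine ⟨by simp [h1], fun j => ?_, fun j => ?_⟩
    · simp [h1, h2, e1]
    · simp [h3, e2]
  | h2 g i ih =>
    obtain ⟨h1, h2, h3⟩ := ih
    refine ⟨by simp [h1], fun j => ?_, fun j => ?_⟩
    · simp [h1, h2, e1]
    · simp [h3, e2]

/-- The normal subgroup of elements whose Magnus vector lies in a given submodule. -/
noncomputable def magSub {d n : ℕ} (τ : Fin n → Fin d → ℤ) (S : Submodule (LR d) (Fin n → LR d)) :
    Subgroup (FreeGroup (Fin n)) where
  carrier := {g | (mag τ g).a = 0 ∧ (mag τ g).v ∈ S}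
  one_mem' := by simp
  mul_mem' := by
    rintro x y ⟨h1, h2⟩ ⟨h3, h4⟩
    refine ⟨by simp [h1, h3], ?_⟩
    rw [map_mul, Mag.mul_v]
    exact S.add_mem h2 (S.smul_mem _ h4)
  inv_mem' := by
    rintro x ⟨h1, h2⟩
    refine ⟨by simp [h1], ?_⟩
    rw [map_inv, Mag.inv_v]
    exact S.neg_mem (S.smul_mem _ h2)

lemma mem_magSub {d n : ℕ} {τ : Fin n → Fin d → ℤ} {S : Submodule (LR d) (Fin n → LR d)}
    {g : FreeGroup (Fin n)} : g ∈ magSub τ S ↔ (mag τ g).a = 0 ∧ (mag τ g).v ∈ S := Iff.rfl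

instance {d n : ℕ} (τ : Fin n → Fin d → ℤ) (S : Submodule (LR d) (Fin n → LR d)) :
    (magSub τ S).Normal := by
  constructor
  intro x hx g
  rw [mem_magSub] at hx ⊢
  obtain ⟨h1, h2⟩ := hx
  refine ⟨by simp [h1], ?_⟩
  have : (mag τ (g * x * g⁻¹)).v = mono (mag τ g).a • (mag τ x).v := by
    simp only [map_mul, map_inv, Mag.mul_v, Mag.mul_a, Mag.inv_v, h1, add_zero, smul_neg, smul_smul,
      ← mono_add, add_neg_cancel, mono_zero, one_smul]
    abel
  rw [this]
  exact S.smul_mem _ h2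

lemma derived_le_magSub {d n : ℕ} (τ : Fin n → Fin d → ℤ) (S : Submodule (LR d) (Fin n → LR d)) :
    derivedSeries (FreeGroup (Fin n)) 2 ≤ magSub τ S := by
  intro g hg
  have : mag τ g ∈ derivedSeries (Mag d n) 2 :=
    map_derivedSeries_le_derivedSeries (mag τ) 2 (Subgroup.mem_map_of_mem _ hg)
  rw [Mag.derived_two, Subgroup.mem_bot] at this
  rw [mem_magSub, this]
  simp

theorem freeness {m d : ℕ} (r : Fin m → FreeGroup (Fin (m + d)))
    (φ : FreeGroup (Fin (m + d)) ≃* FreeGroup (Fin (m + d)))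
    (h0 : ∀ i (j : Fin d), ex (φ (r i)) (Fin.natAdd m j) = 0)
    (hdet : (Matrix.of fun i j : Fin m => ex (φ (r i)) (Fin.castAdd d j)).det ≠ 0)
    (h : FreeGroup (Fin d))
    (hh : φ.symm (FreeGroup.map (Fin.natAdd m) h) ∈ metabelianRel (Set.range r)) :
    h ∈ derivedSeries (FreeGroup (Fin d)) 2 := by
  let S : Submodule (LR d) (Fin (m + d) → LR d) :=
    Submodule.span _ (Set.range fun i => (mag (wt m d) (φ (r i))).v)
  let T := (magSub (wt m d) S).comap φ.toMonoidHom
  have hle : metabelianRel (Set.range r) ≤ T := by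
    apply Subgroup.normalClosure_le_normal
    rintro g (⟨i, rfl⟩ | hg)
    · change φ (r i) ∈ magSub (wt m d) S
      refine ⟨?_, Submodule.subset_span ⟨i, rfl⟩⟩
      rw [mag_a, Fin.sum_univ_add]
      simp [h0]
    · exact derived_le_magSub _ _
        (map_derivedSeries_le_derivedSeries φ.toMonoidHom 2 (Subgroup.mem_map_of_mem _ hg))
  have hT : FreeGroup.map (Fin.natAdd m) h ∈ magSub (wt m d) S := by
    have := hle hh
    simpa [T] using this
  obtain ⟨ha, hv⟩ := hT
  obtain ⟨e1, e2, e3⟩ := mag_incl (m := m) h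
  obtain ⟨c, hc⟩ := (Submodule.mem_span_range_iff_exists_fun _).1 hv
  let B : Matrix (Fin m) (Fin m) (LR d) :=
    Matrix.of fun i j => (mag (wt m d) (φ (r i))).v (Fin.castAdd d j)
  have hB : B.det ≠ 0 := by
    intro h
    apply hdet
    have := congrArg (aug d) h
    rw [map_zero, RingHom.map_det] at this
    rw [← this]
    congr 1
    ext i j
    simp [B, aug_mag]
  have hc0 : c = 0 := by
    apply Matrix.eq_zero_of_vecMul_eq_zero hB
    ext1 j
    have := congrFun hc (Fin.castAdd d j)
    rw [e3, Finset.sum_apply] at this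
    simpa [Matrix.vecMul, dotProduct, B] using this
  have hz : (mag (wt m d) (FreeGroup.map (Fin.natAdd m) h)).v = 0 := by
    rw [← hc, hc0]; simp
  apply magnus_kernel
  · ext1 j
    rw [← e2, hz]; rfl
  · rw [← mag_a_id, ← e1, ha]


/-! ### Nielsen moves -/

/-- The endomorphism `a_q ↦ a_q a_p^ε`. -/
def elemHom {n : ℕ} (p q : Fin n) (ε : ℤ) : FreeGroup (Fin n) →* FreeGroup (Fin n) :=
  FreeGroup.lift fun j =>
    if j = q then FreeGroup.of q * FreeGroup.of p ^ ε else FreeGroup.of j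

lemma elemHom_comp {n : ℕ} {p q : Fin n} (h : p ≠ q) (ε : ℤ) :
    (elemHom p q ε).comp (elemHom p q (-ε)) = MonoidHom.id _ := by
  ext j
  by_cases hj : j = q
  · subst hj; simp [elemHom, h]
  · simp [elemHom, hj]

/-- The Nielsen automorphism `a_q ↦ a_q a_p^ε`. -/
def elemEquiv {n : ℕ} {p q : Fin n} (h : p ≠ q) (ε : ℤ) : FreeGroup (Fin n) ≃* FreeGroup (Fin n) :=
  MonoidHom.toMulEquiv (elemHom p q ε) (elemHom p q (-ε))
    (by simpa using elemHom_comp h (-ε)) (elemHom_comp h ε)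

lemma ex_elem {n : ℕ} {p q : Fin n} (h : p ≠ q) (ε : ℤ) (g : FreeGroup (Fin n)) :
    ex (elemEquiv h ε g) = ex g + Pi.single p (ε * ex g q) := by
  have hE : ∀ g, elemEquiv h ε g = elemHom p q ε g := fun _ => rfl
  rw [hE]
  have step : ∀ g i, ex (elemHom p q ε (g * FreeGroup.of i)) -
      (ex (g * FreeGroup.of i) + Pi.single p (ε * ex (g * FreeGroup.of i) q)) =
      ex (elemHom p q ε g) - (ex g + Pi.single p (ε * ex g q)) := by
    intro g i
    have : ex (elemHom p q ε (FreeGroup.of i)) = Pi.single i 1 +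
        Pi.single p (ε * (Pi.single i 1 : Fin n → ℤ) q) := by
      by_cases hi : i = q
      · subst hi; simp [elemHom, ← Pi.single_smul]
      · simp [elemHom, hi, Ne.symm hi]
    rw [map_mul, ex_mul, this]
    simp only [ex_mul, ex_of, Pi.add_apply, mul_add, Pi.single_add]
    abel
  have : ex (elemHom p q ε g) - (ex g + Pi.single p (ε * ex g q)) = 0 := by
    induction g using freeGroup_right_induction with
    | one => simp
    | h1 g i ih => rw [step, ih]
    | h2 g i ih => rw [← step, inv_mul_cancel_right, ih]
  exact sub_eq_zero.1 this

/-- Reduce the coordinates of one vector from position `k` on. -/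
lemma reduce_row {n : ℕ} (r : FreeGroup (Fin n)) (k : ℕ) (hk : k < n)
    (P : (FreeGroup (Fin n) ≃* FreeGroup (Fin n)) → Prop)
    (hP : ∀ φ, P φ → ∀ p q : Fin n, k ≤ p → k ≤ q → ∀ (h : p ≠ q) ε, P (φ.trans (elemEquiv h ε)))
    (hex : ∃ φ, P φ) :
    ∃ φ, P φ ∧ ∀ j : Fin n, k < j → ex (φ r) j = 0 := by
  classical
  let μ : (FreeGroup (Fin n) ≃* FreeGroup (Fin n)) → ℕ := fun φ =>
    ∑ j ∈ Finset.univ.filter (fun j : Fin n => k ≤ j), (ex (φ r) j).natAbs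
  obtain ⟨φ, hφ, hmin⟩ : ∃ φ, P φ ∧ ∀ φ', P φ' → μ φ ≤ μ φ' := by
    obtain ⟨φ, hφ, h⟩ := WellFounded.has_min (InvImage.wf μ Nat.lt_wfRel.wf) {φ | P φ} hex
    exact ⟨φ, hφ, fun φ' h' => not_lt.1 (h φ' h')⟩
  have key : ∀ p q : Fin n, k ≤ p → k ≤ q → p ≠ q → ex (φ r) p ≠ 0 → ex (φ r) q ≠ 0 →
      ¬ (ex (φ r) q).natAbs ≤ (ex (φ r) p).natAbs := by
    intro p q hp hq hpq h1 h2 hle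
    obtain ⟨ε, hε⟩ : ∃ ε : ℤ, (ex (φ r) p + ε * ex (φ r) q).natAbs < (ex (φ r) p).natAbs := by
      rcases lt_or_gt_of_ne h1 with a | a <;> rcases lt_or_gt_of_ne h2 with b | b
      · exact ⟨-1, by omega⟩
      · exact ⟨1, by omega⟩
      · exact ⟨1, by omega⟩
      · exact ⟨-1, by omega⟩
    have := hmin _ (hP φ hφ p q hp hq hpq ε)
    refine absurd this (not_le.2 ?_)
    apply Finset.sum_lt_sum
    · intro j _
      simp only [MulEquiv.trans_apply, ex_elem, Pi.add_apply]
      by_cases hj : j = p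
      · subst hj; simpa using hε.le
      · simp [hj]
    · refine ⟨p, by simpa using hp, ?_⟩
      simpa [ex_elem] using hε
  by_cases hall : ∀ j : Fin n, k < j → ex (φ r) j = 0
  · exact ⟨φ, hφ, hall⟩
  push Not at hall
  obtain ⟨p, hkp, hp⟩ := hall
  have hother : ∀ j : Fin n, k ≤ j → j ≠ p → ex (φ r) j = 0 := by
    intro j hj hjp
    by_contra hne
    rcases le_total (ex (φ r) j).natAbs (ex (φ r) p).natAbs with h | h
    · exact key p j hkp.le hj (Ne.symm hjp) hp hne h
    · exact key j p hj hkp.le hjp hne hp h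
  let k' : Fin n := ⟨k, hk⟩
  have hne : k' ≠ p := by intro h; rw [← h] at hkp; simp [k'] at hkp
  refine ⟨(φ.trans (elemEquiv hne 1)).trans (elemEquiv hne.symm (-1)),
    hP _ (hP _ hφ _ _ le_rfl hkp.le _ _) _ _ hkp.le le_rfl _ _, ?_⟩
  intro j hj
  have hk0 : ex (φ r) k' = 0 := hother k' le_rfl hne
  have hjk : j ≠ k' := by intro h; rw [h] at hj; simp [k'] at hj
  simp only [MulEquiv.trans_apply, ex_elem, Pi.add_apply]
  by_cases hjp : j = p
  · subst hjp
    simp [hjk, hk0]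
  · simp [hjk, hjp, hother j hj.le hjp]

lemma triangularize {n m : ℕ} (hmn : m ≤ n) (r : Fin m → FreeGroup (Fin n)) (k : ℕ) (hk : k ≤ m) :
    ∃ φ : FreeGroup (Fin n) ≃* FreeGroup (Fin n),
      ∀ i : Fin m, (i : ℕ) < k → ∀ j : Fin n, (i : ℕ) < j → ex (φ (r i)) j = 0 := by
  induction k with
  | zero => exact ⟨MulEquiv.refl _, fun i hi => absurd hi (Nat.not_lt_zero _)⟩
  | succ k ih =>
    obtain ⟨φ, h1, h2⟩ := reduce_row (r ⟨k, hk⟩) k (lt_of_lt_of_le hk hmn)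
      (fun φ => ∀ i : Fin m, (i : ℕ) < k → ∀ j : Fin n, (i : ℕ) < j → ex (φ (r i)) j = 0)
      (by
        intro φ hφ p q hp hq hpq ε i hi j hj
        simp only [MulEquiv.trans_apply, ex_elem, Pi.add_apply]
        rw [hφ i hi j hj, hφ i hi q (lt_of_lt_of_le hi hq)]
        simp) (ih (by omega))
    refine ⟨φ, fun i hi j hj => ?_⟩
    rcases Nat.lt_succ_iff_lt_or_eq.1 hi with h | h
    · exact h1 i h j hj
    · have : i = ⟨k, hk⟩ := Fin.ext h
      subst this
      exact h2 j hj

lemma exists_linear {n : ℕ} (φ : FreeGroup (Fin n) →* FreeGroup (Fin n)) :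
    ∃ T : (Fin n → ℤ) →ₗ[ℤ] (Fin n → ℤ), ∀ g, ex (φ g) = T (ex g) := by
  let f := (exHom n).comp φ
  refine ⟨(AddMonoidHom.toMultiplicative.symm (vecHom fun i => f (FreeGroup.of i))).toIntLinearMap, fun g => ?_⟩
  exact congrArg Multiplicative.toAdd (hom_eq_vecHom f g)

lemma linearIndependent_ex {n m : ℕ} (r : Fin m → FreeGroup (Fin n))
    (φ : FreeGroup (Fin n) ≃* FreeGroup (Fin n)) (h : LinearIndependent ℤ fun i => ex (r i)) :
    LinearIndependent ℤ fun i => ex (φ (r i)) := by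
  obtain ⟨T, hT⟩ := exists_linear φ.toMonoidHom
  obtain ⟨T', hT'⟩ := exists_linear φ.symm.toMonoidHom
  have hT2 : ∀ g, ex (φ g) = T (ex g) := hT
  have hT3 : ∀ g, ex (φ.symm g) = T' (ex g) := hT'
  have inj : Function.Injective T := by
    apply Function.LeftInverse.injective (g := T')
    intro v
    obtain ⟨g, rfl⟩ := ex_surj v
    rw [← hT2, ← hT3]; simp
  have := h.map' T (LinearMap.ker_eq_bot.2 inj)
  have e : (fun i => ex (φ (r i))) = T ∘ fun i => ex (r i) := funext fun i => hT2 _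
  rw [e]
  exact this

lemma det_ne_zero_of_linearIndependent {m d : ℕ} (u : Fin m → Fin (m + d) → ℤ)
    (h : LinearIndependent ℤ u) (h0 : ∀ i j, u i (Fin.natAdd m j) = 0) :
    (Matrix.of fun i j : Fin m => u i (Fin.castAdd d j)).det ≠ 0 := by
  intro hdet
  obtain ⟨v, hv, hv0⟩ := Matrix.exists_vecMul_eq_zero_iff.2 hdet
  apply hv
  have := Fintype.linearIndependent_iff.1 h v
  apply funext
  apply this
  ext j
  refine Fin.addCases (fun j => ?_) (fun j => ?_) j
  · have := congrFun hv0 j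
    simpa [Matrix.vecMul, dotProduct] using this
  · simp [h0]

theorem good_basis {m d : ℕ} (r : Fin m → FreeGroup (Fin (m + d)))
    (h : LinearIndependent ℤ fun i => ex (r i)) :
    ∃ φ : FreeGroup (Fin (m + d)) ≃* FreeGroup (Fin (m + d)),
      (∀ i (j : Fin d), ex (φ (r i)) (Fin.natAdd m j) = 0) ∧
      (Matrix.of fun i j : Fin m => ex (φ (r i)) (Fin.castAdd d j)).det ≠ 0 := by
  obtain ⟨φ, hφ⟩ := triangularize (Nat.le_add_right m d) r m le_rfl
  have h0 : ∀ i (j : Fin d), ex (φ (r i)) (Fin.natAdd m j) = 0 := by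
    intro i j
    apply hφ i i.2
    simp; omega
  exact ⟨φ, h0, det_ne_zero_of_linearIndependent _ (linearIndependent_ex r φ h) h0⟩


/-! ### Virtually abelian subgroups -/

lemma virtuallyAbelian_of_map {G : Type*} [Group G] (hG : derivedSeries G 2 = ⊥) (P : Subgroup G)
    (S : Subgroup (Abelianization G)) [hS : Finite S] (h : P ≤ S.comap Abelianization.of) :
    VirtuallyAbelian P := by
  let f : P →* Abelianization G := Abelianization.of.comp P.subtype
  have : Finite f.range := by
    refine Set.Finite.subset (s := (S : Set (Abelianization G))) (Set.toFinite _) ?_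
    rintro _ ⟨x, rfl⟩
    exact h x.2
  refine ⟨f.ker, ?_, inferInstance⟩
  intro x hx y hy
  have hx' : (x : G) ∈ commutator G := by rw [← Abelianization.ker_of]; exact hx
  have hy' : (y : G) ∈ commutator G := by rw [← Abelianization.ker_of]; exact hy
  rw [derivedSeries_succ, derivedSeries_one,
    Subgroup.commutator_eq_bot_iff_le_centralizer] at hG
  apply Subtype.ext
  exact ((Subgroup.mem_centralizer_iff.1 (hG hx')) _ hy').symm

lemma finite_closure_of_torsion {Q : Type*} [CommGroup Q] {k : ℕ} (x : Fin k → Q)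
    (h : ∀ i, IsOfFinOrder (x i)) : Finite (Subgroup.closure (Set.range x)) := by
  have hle : Subgroup.closure (Set.range x) ≤ CommGroup.torsion Q := by
    rw [Subgroup.closure_le]
    rintro _ ⟨i, rfl⟩
    exact h i
  have : Group.FG (Subgroup.closure (Set.range x)) := by
    rw [Group.fg_iff_subgroup_fg]
    exact (Subgroup.fg_iff _).2 ⟨_, rfl, Set.finite_range x⟩
  apply CommGroup.finite_of_fg_isMulTorsion
  intro y
  have := hle y.2
  exact Submonoid.isOfFinOrder_coe.1 this

lemma torsion_coeff {m d : ℕ} (u : Fin m → Fin (m + d) → ℤ)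
    (h0 : ∀ i j, u i (Fin.natAdd m j) = 0) (j : Fin m) :
    ∃ c : Fin m → ℤ, ∑ i, c i • u i =
      (Matrix.of fun i j : Fin m => u i (Fin.castAdd d j)).det •
        (Pi.single (Fin.castAdd d j) 1 : Fin (m + d) → ℤ) := by
  set B := Matrix.of fun i j : Fin m => u i (Fin.castAdd d j) with hB
  refine ⟨fun i => B.adjugate j i, ?_⟩
  ext k
  refine Fin.addCases (fun k => ?_) (fun k => ?_) k
  · have := congrFun (congrFun B.adjugate_mul j) k
    rw [Matrix.mul_apply] at this
    simp only [Finset.sum_apply, Pi.smul_apply, smul_eq_mul]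
    simp only [hB, Matrix.of_apply] at this ⊢
    rw [this]
    by_cases hjk : k = j
    · subst hjk; simp
    · have hjk' : Fin.castAdd d k ≠ Fin.castAdd d j := by simpa [Fin.ext_iff] using hjk
      simp [Ne.symm hjk, hjk']
  · have hjk' : Fin.natAdd m k ≠ Fin.castAdd d j := by
      have := j.2
      simp [Fin.ext_iff]; omega
    simp [h0, hjk']

lemma torsion_of_coeff {n m : ℕ} {Q : Type*} [CommGroup Q] (f : FreeGroup (Fin n) →* Q)
    (r : Fin m → FreeGroup (Fin n)) (hr : ∀ i, f (r i) = 1) (j : Fin n) (D : ℤ) (hD : D ≠ 0)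
    (c : Fin m → ℤ) (hc : ∑ i, c i • ex (r i) = D • (Pi.single j 1 : Fin n → ℤ)) :
    IsOfFinOrder (f (FreeGroup.of j)) := by
  rw [isOfFinOrder_iff_zpow_eq_one]
  refine ⟨D, hD, ?_⟩
  rw [← map_zpow, hom_eq_vecHom f, ex_zpow, ex_of, ← hc, ofAdd_sum, map_prod]
  apply Finset.prod_eq_one
  intro i _
  rw [ofAdd_zsmul, map_zpow, ← hom_eq_vecHom, hr, one_zpow]

lemma presented_metabelian {n : ℕ} (R : Set (FreeGroup (Fin n))) :
    derivedSeries (MetabelianPresented R) 2 = ⊥ := by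
  rw [← map_derivedSeries_eq (QuotientGroup.mk'_surjective (metabelianRel R)), eq_bot_iff,
    Subgroup.map_le_iff_le_comap]
  intro x hx
  rw [Subgroup.mem_comap, Subgroup.mem_bot, QuotientGroup.mk'_apply, QuotientGroup.eq_one_iff]
  exact Subgroup.subset_normalClosure (Or.inr hx)

/-- The structural conclusion. -/
def GoodGroup (m k : ℕ) (G : Type) [Group G] : Prop :=
  ∃ H K : Subgroup G,
    H.FG ∧ K.FG ∧
    Nonempty (↥H ≃* FreeMetabelian k) ∧
    (∃ s : Fin m → G, K = Subgroup.closure (Set.range s)) ∧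
    VirtuallyAbelian ↥K ∧
    VirtuallyAbelian ↥(Subgroup.normalClosure (K : Set G)) ∧
    H ⊔ K = ⊤ ∧
    (∀ g : G, ∃ l ∈ Subgroup.normalClosure (K : Set G), ∃ h ∈ H, g = l * h)

lemma goodGroup_of {m k : ℕ} {G : Type} [Group G] (hG : derivedSeries G 2 = ⊥) (H : Subgroup G)
    (hH : H.FG) (e : Nonempty (↥H ≃* FreeMetabelian k)) (s : Fin m → G)
    (hs : ∀ i, IsOfFinOrder (Abelianization.of (s i)))
    (htop : H ⊔ Subgroup.closure (Set.range s) = ⊤) : GoodGroup m k G := by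
  have hfin := finite_closure_of_torsion (fun i => Abelianization.of (s i)) hs
  set S := Subgroup.closure (Set.range fun i => Abelianization.of (s i)) with hS
  have hK : Subgroup.closure (Set.range s) ≤ S.comap Abelianization.of := by
    rw [Subgroup.closure_le]
    rintro _ ⟨i, rfl⟩
    exact Subgroup.subset_closure ⟨i, rfl⟩
  refine ⟨H, Subgroup.closure (Set.range s), hH, (Subgroup.fg_iff _).2 ⟨_, rfl, Set.finite_range s⟩,
    e, ⟨s, rfl⟩, virtuallyAbelian_of_map hG _ S hK,
    virtuallyAbelian_of_map hG _ S (Subgroup.normalClosure_le_normal hK), htop, ?_⟩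
  intro g
  have hg : g ∈ Subgroup.normalClosure (Subgroup.closure (Set.range s) : Set G) ⊔ H := by
    have : g ∈ H ⊔ Subgroup.closure (Set.range s) := by rw [htop]; trivial
    have hle : H ⊔ Subgroup.closure (Set.range s) ≤
        Subgroup.normalClosure (Subgroup.closure (Set.range s) : Set G) ⊔ H :=
      sup_le le_sup_right (le_trans Subgroup.le_normalClosure le_sup_left)
    exact hle this
  obtain ⟨l, hl, h, hh, rfl⟩ := Subgroup.mem_sup_of_normal_left.1 hg
  exact ⟨l, hl, h, hh, rfl⟩

lemma fg_range_freeGroup {d : ℕ} {G : Type*} [Group G] (f : FreeGroup (Fin d) →* G) :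
    f.range.FG := by
  rw [MonoidHom.range_eq_map, ← FreeGroup.closure_range_of, MonoidHom.map_closure]
  exact (Subgroup.fg_iff _).2 ⟨_, rfl, (Set.finite_range _).image _⟩

theorem goodGroup_le {m d : ℕ} (r : Fin m → FreeGroup (Fin (m + d)))
    (h : LinearIndependent ℤ fun i => ex (r i)) :
    GoodGroup m d (MetabelianPresented (Set.range r)) := by
  obtain ⟨φ, h0, hdet⟩ := good_basis r h
  let ρ : FreeGroup (Fin (m + d)) →* MetabelianPresented (Set.range r) :=
    (QuotientGroup.mk' (metabelianRel (Set.range r))).comp φ.symm.toMonoidHom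
  have hρ : Function.Surjective ρ :=
    (QuotientGroup.mk'_surjective _).comp φ.symm.surjective
  let σ : FreeGroup (Fin d) →* MetabelianPresented (Set.range r) :=
    ρ.comp (FreeGroup.map (Fin.natAdd m))
  have hker : σ.ker = derivedSeries (FreeGroup (Fin d)) 2 := by
    apply le_antisymm
    · intro x hx
      apply freeness r φ h0 hdet x
      exact (QuotientGroup.eq_one_iff _).1 hx
    · intro x hx
      have : σ x ∈ derivedSeries (MetabelianPresented (Set.range r)) 2 :=
        map_derivedSeries_le_derivedSeries σ 2 (Subgroup.mem_map_of_mem _ hx)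
      rw [presented_metabelian, Subgroup.mem_bot] at this
      exact this
  refine goodGroup_of (presented_metabelian _) σ.range (fg_range_freeGroup σ)
    ⟨(QuotientGroup.quotientKerEquivRange σ).symm.trans
      (QuotientGroup.quotientMulEquivOfEq hker)⟩
    (fun j => ρ (FreeGroup.of (Fin.castAdd d j))) ?_ ?_
  · intro j
    obtain ⟨c, hc⟩ := torsion_coeff (fun i => ex (φ (r i))) h0 j
    refine torsion_of_coeff (Abelianization.of.comp ρ) (fun i => φ (r i)) ?_ _ _ hdet c hc
    intro i
    have : ρ (φ (r i)) = 1 := by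
      simp only [ρ, MonoidHom.comp_apply]
      change QuotientGroup.mk' _ (φ.symm (φ (r i))) = 1
      rw [φ.symm_apply_apply]
      exact (QuotientGroup.eq_one_iff _).2 (Subgroup.subset_normalClosure (Or.inl ⟨i, rfl⟩))
    rw [MonoidHom.comp_apply, this, map_one]
  · rw [eq_top_iff, ← MonoidHom.range_eq_top.2 hρ, MonoidHom.range_eq_map,
      ← FreeGroup.closure_range_of, MonoidHom.map_closure, Subgroup.closure_le]
    rintro _ ⟨_, ⟨j, rfl⟩, rfl⟩
    refine Fin.addCases (fun j => ?_) (fun j => ?_) j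
    · exact (le_sup_right : _ ≤ σ.range ⊔ _) (Subgroup.subset_closure ⟨j, rfl⟩)
    · refine (le_sup_left : σ.range ≤ _) ⟨FreeGroup.of j, ?_⟩
      simp [σ]

theorem goodGroup_ge {n m : ℕ} (hnm : n ≤ m) (r : Fin m → FreeGroup (Fin n)) (ι : Fin n → Fin m)
    (h : LinearIndependent ℤ fun i => ex (r (ι i))) :
    GoodGroup m 0 (MetabelianPresented (Set.range r)) := by
  let ρ := QuotientGroup.mk' (metabelianRel (Set.range r))
  have h0 : ∀ i (j : Fin 0), (fun i => ex (r (ι i)) : Fin n → Fin (n + 0) → ℤ) i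
    (Fin.natAdd n j) = 0 := fun i j => j.elim0
  have hdet := det_ne_zero_of_linearIndependent (m := n) (d := 0) (fun i => ex (r (ι i))) h h0
  have hsub : Subsingleton (FreeGroup (Fin 0)) := inferInstance
  have hsub2 : Subsingleton (FreeMetabelian 0) := by
    constructor
    intro a b
    induction a using QuotientGroup.induction_on
    induction b using QuotientGroup.induction_on
    congr 1
    exact Subsingleton.elim _ _
  refine goodGroup_of (presented_metabelian _) ⊥ ((Subgroup.fg_iff _).2 ⟨∅, by simp, by simp⟩)
    ⟨{ toFun := fun _ => 1, invFun := fun _ => 1, left_inv := fun _ => Subsingleton.elim _ _,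
       right_inv := fun _ => Subsingleton.elim _ _, map_mul' := fun _ _ => by simp }⟩
    (fun j => if hj : (j : ℕ) < n then ρ (FreeGroup.of ⟨j, hj⟩) else 1) ?_ ?_
  · intro j
    split_ifs with hj
    · obtain ⟨c, hc⟩ := torsion_coeff (m := n) (d := 0) (fun i => ex (r (ι i))) h0 ⟨j, hj⟩
      refine torsion_of_coeff (Abelianization.of.comp ρ) (fun i => r (ι i)) ?_ ⟨j, hj⟩ _ hdet c hc
      intro i
      have : ρ (r (ι i)) = 1 :=
        (QuotientGroup.eq_one_iff _).2 (Subgroup.subset_normalClosure (Or.inl ⟨ι i, rfl⟩))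
      rw [MonoidHom.comp_apply, this, map_one]
    · simp
  · rw [bot_sup_eq, eq_top_iff, ← MonoidHom.range_eq_top.2 (QuotientGroup.mk'_surjective _),
      MonoidHom.range_eq_map, ← FreeGroup.closure_range_of, MonoidHom.map_closure,
      Subgroup.closure_le]
    rintro _ ⟨_, ⟨j, rfl⟩, rfl⟩
    refine Subgroup.subset_closure ⟨Fin.castLE hnm j, ?_⟩
    simp [ρ]


/-! ### Anti-concentration -/

section AntiConcentration
open MeasureTheory MeasureTheory.Measure AddCircle Filter Topology

/-- The value of a letter under an integral functional. -/
def lv {n : ℕ} (c : Fin n → ℤ) (x : Fin n × Bool) : ℤ := if x.2 then c x.1 else - c x.1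

lemma dot_ex_mk {n : ℕ} (c : Fin n → ℤ) (L : List (Fin n × Bool)) :
    c ⬝ᵥ ex (FreeGroup.mk L) = (L.map (lv c)).sum := by
  induction L with
  | nil =>
    rw [← FreeGroup.one_eq_mk]; simp
  | cons x L ih =>
    have h : FreeGroup.mk (x :: L) = FreeGroup.mk [x] * FreeGroup.mk L := by simp
    have h2 : c ⬝ᵥ ex (FreeGroup.mk [x]) = lv c x := by
      obtain ⟨i, b⟩ := x
      cases b
      · have : FreeGroup.mk [(i, false)] = (FreeGroup.of i)⁻¹ := rfl
        rw [this]; simp [lv]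
      · have : FreeGroup.mk [(i, true)] = FreeGroup.of i := rfl
        rw [this]; simp [lv]
    rw [h, ex_mul, dotProduct_add, h2, ih, List.map_cons, List.sum_cons]

lemma dot_ex_ofFn {n l : ℕ} (c : Fin n → ℤ) (u : Fin l → Fin n × Bool) :
    c ⬝ᵥ ex (FreeGroup.mk (List.ofFn u)) = ∑ t, lv c (u t) := by
  rw [dot_ex_mk, List.map_ofFn, List.sum_ofFn]; rfl

instance factOne : Fact ((0 : ℝ) < 1) := ⟨one_pos⟩

/-- Haar measure on the circle. -/
noncomputable abbrev hm : Measure (AddCircle (1 : ℝ)) := haarAddCircle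

lemma integral_fourier_eq (k : ℤ) :
    ∫ θ, (fourier k θ : ℂ) ∂hm = if k = 0 then 1 else 0 := by
  split_ifs with h
  · subst h; simp
  · exact integral_eq_zero_of_add_right_eq_neg (μ := haarAddCircle)
      (fourier_add_half_inv_index h one_pos)

lemma fourier_sum_eq {ι : Type*} (s : Finset ι) (f : ι → ℤ) (θ : AddCircle (1 : ℝ)) :
    (fourier (∑ i ∈ s, f i) θ : ℂ) = ∏ i ∈ s, fourier (f i) θ := by
  classical
  induction s using Finset.induction_on with
  | empty => simp
  | insert a s ha ih => rw [Finset.sum_insert ha, Finset.prod_insert ha, fourier_add, ih]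

/-- Two-point character sum. -/
noncomputable def hh (θ : AddCircle (1 : ℝ)) : ℝ := ‖(fourier 1 θ + fourier (-1) θ : ℂ)‖

lemma hh_zsmul (k : ℤ) (θ : AddCircle (1 : ℝ)) :
    hh (k • θ) = ‖(fourier k θ + fourier (-k) θ : ℂ)‖ := by
  simp only [hh, fourier_apply, one_zsmul, neg_zsmul]

lemma norm_fourier_apply (k : ℤ) (θ : AddCircle (1 : ℝ)) : ‖(fourier k θ : ℂ)‖ = 1 := by
  rw [fourier_apply]; exact Circle.norm_coe _

lemma hh_le (θ : AddCircle (1 : ℝ)) : hh θ ≤ 2 := by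
  refine (norm_add_le _ _).trans ?_
  rw [norm_fourier_apply, norm_fourier_apply]; norm_num

lemma hh_nonneg (θ : AddCircle (1 : ℝ)) : 0 ≤ hh θ := norm_nonneg _

lemma hh_cont : Continuous hh := by
  unfold hh; fun_prop

lemma hh_lt_ae : ∀ᵐ θ ∂hm, hh θ < 2 := by
  have hmp : MeasurePreserving (fun θ : AddCircle (1 : ℝ) => (2 : ℤ) • θ) hm hm :=
    measurePreserving_zsmul hm (by norm_num)
  have h0 : ∀ᵐ θ ∂hm, θ ≠ 0 := by
    have : hm {(0 : AddCircle (1 : ℝ))} = 0 := by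
      have hv : (volume : Measure (AddCircle (1 : ℝ))) = hm := by
        rw [AddCircle.volume_eq_smul_haarAddCircle]; simp
      rw [← hv]
      have := AddCircle.volume_closedBall (T := 1) (x := (0 : AddCircle (1 : ℝ))) 0
      simpa using this
    exact measure_eq_zero_iff_ae_notMem.1 this
  have h1 := hmp.quasiMeasurePreserving.ae h0
  filter_upwards [h1] with θ hθ
  refine lt_of_le_of_ne (hh_le θ) fun h => hθ ?_
  have hn1 := norm_fourier_apply 1 θ
  have hn2 := norm_fourier_apply (-1) θ
  have heq : (fourier 1 θ : ℂ) = fourier (-1) θ := by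
    apply eq_of_norm_eq_of_norm_add_eq (hn1.trans hn2.symm)
    rw [hn1, hn2]
    change hh θ = _
    rw [h]; norm_num
  have h2 : (fourier 2 θ : ℂ) = 1 := by
    have : (2 : ℤ) = 1 + 1 := by norm_num
    rw [this, fourier_add]
    nth_rewrite 2 [heq]
    rw [← fourier_add]; simp
  rw [fourier_apply] at h2
  have h3 : toCircle ((2 : ℤ) • θ) = toCircle (0 : AddCircle (1 : ℝ)) := by
    rw [toCircle_zero]
    exact Circle.coe_eq_one.1 h2
  exact injective_toCircle one_ne_zero h3

/-- The uniform bound. -/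
noncomputable def eps (n l : ℕ) : ℝ :=
  ∫ θ, ((2 * ((n : ℝ) - 1) + hh θ) / (2 * n)) ^ l ∂hm

lemma eps_nonneg {n : ℕ} (hn : 1 ≤ n) (l : ℕ) : 0 ≤ eps n l := by
  have hn' : (1 : ℝ) ≤ n := by exact_mod_cast hn
  apply integral_nonneg
  intro θ
  have := hh_nonneg θ
  exact pow_nonneg (div_nonneg (by linarith) (by linarith)) _

lemma eps_tendsto {n : ℕ} (hn : 1 ≤ n) : Tendsto (eps n) atTop (𝓝 0) := by
  have hn' : (1 : ℝ) ≤ n := by exact_mod_cast hn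
  have := tendsto_integral_of_dominated_convergence (μ := hm)
    (F := fun l θ => ((2 * ((n : ℝ) - 1) + hh θ) / (2 * n)) ^ l) (f := fun _ => (0 : ℝ))
    (fun _ => 1) ?_ (integrable_const _) ?_ ?_
  · simp only [integral_zero] at this
    exact this
  · intro l
    apply Continuous.aestronglyMeasurable
    have := hh_cont
    fun_prop
  · intro l
    refine Eventually.of_forall fun θ => ?_
    have h1 := hh_nonneg θ
    have h2 := hh_le θ
    have h3 : 0 ≤ (2 * ((n : ℝ) - 1) + hh θ) / (2 * n) :=
      div_nonneg (by linarith) (by linarith)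
    rw [Real.norm_of_nonneg (pow_nonneg h3 _)]
    apply pow_le_one₀ h3
    rw [div_le_one (by linarith)]; linarith
  · filter_upwards [hh_lt_ae] with θ hθ
    have h1 := hh_nonneg θ
    apply tendsto_pow_atTop_nhds_zero_of_lt_one
    · exact div_nonneg (by linarith) (by linarith)
    · rw [div_lt_one (by linarith)]; linarith

lemma letter_sum_bound {n : ℕ} (c : Fin n → ℤ) (i : Fin n) (θ : AddCircle (1 : ℝ)) :
    ‖∑ x : Fin n × Bool, (fourier (lv c x) θ : ℂ)‖ ≤ 2 * ((n : ℝ) - 1) + hh (c i • θ) := by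
  rw [Fintype.sum_prod_type]
  simp only [Fintype.sum_bool, lv, if_true, Bool.false_eq_true, if_false]
  refine (norm_sum_le _ _).trans ?_
  simp only [← hh_zsmul]
  rw [← Finset.add_sum_erase _ _ (Finset.mem_univ i), add_comm]
  gcongr
  refine (Finset.sum_le_card_nsmul _ _ 2 fun j _ => hh_le _).trans ?_
  have : 1 ≤ n := i.pos
  rw [Finset.card_erase_of_mem (Finset.mem_univ i), Finset.card_univ, Fintype.card_fin, nsmul_eq_mul,
    Nat.cast_sub this]
  simp [mul_comm]

theorem anti_conc {n : ℕ} (l : ℕ) (c : Fin n → ℤ) (hc : c ≠ 0) :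
    (∑ u : Fin l → Fin n × Bool, if c ⬝ᵥ ex (FreeGroup.mk (List.ofFn u)) = 0 then (1 : ℝ) else 0) ≤
      eps n l * Fintype.card (Fin l → Fin n × Bool) := by
  obtain ⟨i, hi⟩ := Function.ne_iff.1 hc
  have hi : c i ≠ 0 := hi
  have hn' : (1 : ℝ) ≤ n := by exact_mod_cast i.pos
  have e1 : (((∑ u : Fin l → Fin n × Bool,
      if c ⬝ᵥ ex (FreeGroup.mk (List.ofFn u)) = 0 then (1 : ℝ) else 0) : ℝ) : ℂ) =
      ∫ θ, (∑ x : Fin n × Bool, (fourier (lv c x) θ : ℂ)) ^ l ∂hm := by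
    simp_rw [Fintype.sum_pow, ← fourier_sum_eq]
    rw [integral_finsetSum]
    · push_cast
      refine Finset.sum_congr rfl fun u _ => ?_
      rw [integral_fourier_eq, dot_ex_ofFn]
      split_ifs <;> simp
    · intro u _
      exact (ContinuousMap.continuous _).integrable_of_hasCompactSupport
        (HasCompactSupport.of_compactSpace _)
  have hpos : 0 ≤ ∑ u : Fin l → Fin n × Bool,
      if c ⬝ᵥ ex (FreeGroup.mk (List.ofFn u)) = 0 then (1 : ℝ) else 0 :=
    Finset.sum_nonneg fun u _ => by split_ifs <;> simp
  rw [← Complex.norm_of_nonneg hpos, e1]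
  have hmp : MeasurePreserving (fun θ : AddCircle (1 : ℝ) => c i • θ) hm hm :=
    measurePreserving_zsmul hm hi
  have hcont : Continuous fun θ => ((2 * ((n : ℝ) - 1) + hh θ) / (2 * n)) ^ l := by
    have := hh_cont
    fun_prop
  have e2 : eps n l = ∫ θ, ((2 * ((n : ℝ) - 1) + hh (c i • θ)) / (2 * n)) ^ l ∂hm := by
    have := integral_map (μ := hm) hmp.measurable.aemeasurable
      (f := fun θ => ((2 * ((n : ℝ) - 1) + hh θ) / (2 * n)) ^ l) (by
        rw [hmp.map_eq]; exact hcont.aestronglyMeasurable)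
    rw [hmp.map_eq] at this
    exact this
  have hcard : (Fintype.card (Fin l → Fin n × Bool) : ℝ) = (2 * n) ^ l := by
    simp [mul_comm]
  rw [e2, hcard, ← integral_mul_const]
  refine norm_integral_le_of_norm_le ?_ (Eventually.of_forall fun θ => ?_)
  · refine Continuous.integrable_of_hasCompactSupport ?_ (HasCompactSupport.of_compactSpace _)
    have := hcont.comp (continuous_zsmul (c i))
    exact this.mul continuous_const
  · rw [norm_pow, ← mul_pow, div_mul_cancel₀ _ (by linarith)]
    exact pow_le_pow_left₀ (norm_nonneg _) (letter_sum_bound c i θ) _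

end AntiConcentration


/-! ### Counting -/

section Counting
open Filter Topology

/-- Generic rank condition on the exponent vectors. -/
def Gd {n m : ℕ} (v : Fin m → Fin n → ℤ) : Prop :=
  (m ≤ n → LinearIndependent ℤ v) ∧
    (n ≤ m → ∃ ι : Fin n → Fin m, LinearIndependent ℤ fun i => v (ι i))

lemma exists_orth {n m : ℕ} (hmn : m < n) (v : Fin m → Fin n → ℤ) :
    ∃ c : Fin n → ℤ, c ≠ 0 ∧ ∀ i, c ⬝ᵥ v i = 0 := by
  by_contra hcon
  push Not at hcon
  have hinj : Function.Injective (Matrix.mulVecLin (Matrix.of v)) := by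
    rw [injective_iff_map_eq_zero]
    intro c hc
    by_contra h0
    obtain ⟨i, hi⟩ := hcon c h0
    apply hi
    rw [dotProduct_comm]
    exact congrFun hc i
  have := le_of_fin_injective ℤ _ hinj
  omega

lemma Gd_cons {n m : ℕ} (v : Fin m → Fin n → ℤ) (x : Fin n → ℤ) (hv : Gd v)
    (h : m < n → ∃ c : Fin n → ℤ, (∀ i, c ⬝ᵥ v i = 0) ∧ c ⬝ᵥ x ≠ 0) :
    Gd (Fin.cons x v : Fin (m + 1) → Fin n → ℤ) := by
  have key : m + 1 ≤ n → LinearIndependent ℤ (Fin.cons x v : Fin (m + 1) → Fin n → ℤ) := by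
    intro hmn
    obtain ⟨c, hc, hcx⟩ := h (by omega)
    have hli := Fintype.linearIndependent_iff.1 (hv.1 (by omega))
    rw [Fintype.linearIndependent_iff]
    intro g hg
    rw [Fin.sum_univ_succ] at hg
    simp only [Fin.cons_zero, Fin.cons_succ] at hg
    have h1 := congrArg (fun y => c ⬝ᵥ y) hg
    simp only [dotProduct_add, dotProduct_smul, dotProduct_sum, hc, dotProduct_zero, mul_zero,
      Finset.sum_const_zero, add_zero, smul_eq_mul] at h1
    have h0 : g 0 = 0 := (mul_eq_zero.1 h1).resolve_right hcx
    rw [h0, zero_smul, zero_add] at hg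
    intro i
    refine Fin.cases h0 (fun j => hli (fun j => g j.succ) hg j) i
  refine ⟨key, fun hnm => ?_⟩
  rcases Nat.lt_or_ge m n with hlt | hge
  · have : n = m + 1 := by omega
    subst this
    exact ⟨id, key le_rfl⟩
  · obtain ⟨ι, hι⟩ := hv.2 hge
    exact ⟨fun i => (ι i).succ, by simpa using hι⟩

lemma Gd_zero {n : ℕ} (v : Fin 0 → Fin n → ℤ) : Gd v := by
  refine ⟨fun _ => linearIndependent_empty_type, fun h => ?_⟩
  have : n = 0 := by omega
  subst this
  exact ⟨id, linearIndependent_empty_type⟩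

/-- The exponent vectors of the relators. -/
def rows {n m l : ℕ} (w : Fin m → Fin l → Fin n × Bool) : Fin m → Fin n → ℤ :=
  fun i => ex (FreeGroup.mk (List.ofFn (w i)))

lemma rows_cons {n m l : ℕ} (u : Fin l → Fin n × Bool) (w : Fin m → Fin l → Fin n × Bool) :
    rows (Fin.cons u w : Fin (m + 1) → Fin l → Fin n × Bool) =
      Fin.cons (ex (FreeGroup.mk (List.ofFn u))) (rows w) := by
  funext i
  refine Fin.cases ?_ (fun j => ?_) i <;> simp [rows]

open Classical in
lemma bad_bound {n : ℕ} (hn : 1 ≤ n) (l m : ℕ) :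
    (∑ w : Fin m → Fin l → Fin n × Bool, if Gd (rows w) then (0 : ℝ) else 1) ≤
      m * eps n l * Fintype.card (Fin m → Fin l → Fin n × Bool) := by
  induction m with
  | zero =>
    rw [Finset.sum_eq_zero]
    · simp
    · intro w _
      rw [if_pos (Gd_zero _)]
  | succ m ih =>
    set X := Fin l → Fin n × Bool with hX
    have hcardX : (Fintype.card (Fin (m + 1) → X) : ℝ) =
        Fintype.card X * Fintype.card (Fin m → X) := by
      have := Fintype.card_congr (Fin.consEquiv (fun _ : Fin (m + 1) => X))
      rw [Fintype.card_prod] at this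
      rw [← this]
      push_cast
      rfl
    rw [← (Fin.consEquiv (fun _ : Fin (m + 1) => X)).sum_comp, Fintype.sum_prod_type_right]
    have hinner : ∀ w : Fin m → X,
        (∑ u : X, if Gd (rows (Fin.consEquiv (fun _ : Fin (m + 1) => X) (u, w))) then (0 : ℝ) else 1)
          ≤ (if Gd (rows w) then (0 : ℝ) else 1) * Fintype.card X + eps n l * Fintype.card X := by
      intro w
      have heps := eps_nonneg hn l
      by_cases hw : Gd (rows w)
      · rw [if_pos hw, zero_mul, zero_add]
        rcases Nat.lt_or_ge m n with hlt | hge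
        · obtain ⟨c, hc0, hc⟩ := exists_orth hlt (rows w)
          refine le_trans (Finset.sum_le_sum fun u _ => ?_) (anti_conc l c hc0)
          by_cases hu : c ⬝ᵥ ex (FreeGroup.mk (List.ofFn u)) = 0
          · rw [if_pos hu]; split_ifs <;> norm_num
          · rw [if_neg hu, if_pos]
            change Gd (rows (Fin.cons u w : Fin (m + 1) → Fin l → Fin n × Bool))
            rw [rows_cons]
            exact Gd_cons _ _ hw fun _ => ⟨c, hc, hu⟩
        · rw [Finset.sum_eq_zero]
          · positivity
          · intro u _
            rw [if_pos]
            change Gd (rows (Fin.cons u w : Fin (m + 1) → Fin l → Fin n × Bool))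
            rw [rows_cons]
            exact Gd_cons _ _ hw fun h => by omega
      · rw [if_neg hw, one_mul]
        have h1 : (∑ u : X, if Gd (rows (Fin.consEquiv (fun _ : Fin (m + 1) => X) (u, w)))
            then (0 : ℝ) else 1) ≤ ∑ _u : X, (1 : ℝ) :=
          Finset.sum_le_sum fun u _ => by split_ifs <;> norm_num
        rw [Finset.sum_const, Finset.card_univ, nsmul_eq_mul, mul_one] at h1
        have : 0 ≤ eps n l * (Fintype.card X : ℝ) := by positivity
        linarith
    refine (Finset.sum_le_sum fun w _ => hinner w).trans ?_
    rw [Finset.sum_add_distrib, ← Finset.sum_mul, Finset.sum_const, Finset.card_univ, nsmul_eq_mul,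
      hcardX]
    have h2 := mul_le_mul_of_nonneg_right ih (Nat.cast_nonneg (α := ℝ) (Fintype.card X))
    push_cast
    linarith

lemma good_of_Gd {n m l : ℕ} (w : Fin m → Fin l → Fin n × Bool) (h : Gd (rows w)) :
    GoodGroup m (n - m) (RandomMetabelian w) := by
  rcases le_total m n with hmn | hnm
  · obtain ⟨d, rfl⟩ := Nat.exists_eq_add_of_le hmn
    rw [Nat.add_sub_cancel_left]
    exact goodGroup_le (fun i => FreeGroup.mk (List.ofFn (w i))) (h.1 hmn)
  · rw [Nat.sub_eq_zero_of_le hnm]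
    obtain ⟨ι, hι⟩ := h.2 hnm
    exact goodGroup_ge hnm (fun i => FreeGroup.mk (List.ofFn (w i))) ι hι

theorem good_tendsto {n m : ℕ} (hn : 1 ≤ n) :
    Tendsto (fun l : ℕ =>
      (Nat.card {w : Fin m → Fin l → Fin n × Bool // GoodGroup m (n - m) (RandomMetabelian w)} : ℝ) /
        (Nat.card (Fin m → Fin l → Fin n × Bool) : ℝ)) atTop (𝓝 1) := by
  classical
  have hlim : Tendsto (fun l : ℕ => 1 - (m : ℝ) * eps n l) atTop (𝓝 1) := by
    simpa using ((eps_tendsto hn).const_mul (m : ℝ)).const_sub 1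
  have hpos : ∀ l : ℕ, (0 : ℝ) < Fintype.card (Fin m → Fin l → Fin n × Bool) := by
    intro l
    haveI : Nonempty (Fin n) := ⟨⟨0, hn⟩⟩
    exact_mod_cast Fintype.card_pos
  refine tendsto_of_tendsto_of_tendsto_of_le_of_le hlim tendsto_const_nhds ?_ ?_
  · intro l
    have hb := bad_bound hn l m
    simp only [Nat.card_eq_fintype_card]
    rw [le_div_iff₀ (hpos l), Fintype.card_subtype, Finset.card_filter]
    push_cast
    have h1 : (Fintype.card (Fin m → Fin l → Fin n × Bool) : ℝ) ≤
        (∑ w : Fin m → Fin l → Fin n × Bool,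
          if GoodGroup m (n - m) (RandomMetabelian w) then (1 : ℝ) else 0) +
        ∑ w : Fin m → Fin l → Fin n × Bool, if Gd (rows w) then (0 : ℝ) else 1 := by
      rw [← Finset.sum_add_distrib]
      have h2 : (Fintype.card (Fin m → Fin l → Fin n × Bool) : ℝ) =
          ∑ _w : Fin m → Fin l → Fin n × Bool, (1 : ℝ) := by
        rw [Finset.sum_const, Finset.card_univ, nsmul_eq_mul, mul_one]
      rw [h2]
      refine Finset.sum_le_sum fun w _ => ?_
      by_cases hw : Gd (rows w)
      · rw [if_pos hw, if_pos (good_of_Gd w hw)]; norm_num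
      · rw [if_neg hw]; split_ifs <;> norm_num
    linarith
  · intro l
    simp only [Nat.card_eq_fintype_card]
    rw [div_le_one (hpos l)]
    exact_mod_cast Fintype.card_subtype_le _

end Counting


/-- Asymptotically almost surely as `ℓ → ∞`, a random `m`-relator
metabelian group on `n` generators is a product `G = L·H` with `H` free metabelian of rank
`max(n-m,0)` and `L` the virtually abelian normal closure of an `m`-generated virtually
abelian subgroup `K`. -/
theorem random_metabelian_structure {n m : ℕ} (hn : 1 ≤ n) (hm : 1 ≤ m) :
    Filter.Tendsto (fun ℓ : ℕ =>
      (Nat.card {w : Fin m → Fin ℓ → Fin n × Bool //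
          ∃ H K : Subgroup (RandomMetabelian w),
            H.FG ∧ K.FG ∧
            Nonempty (↥H ≃* FreeMetabelian (n - m)) ∧
            (∃ s : Fin m → RandomMetabelian w, K = Subgroup.closure (Set.range s)) ∧
            VirtuallyAbelian ↥K ∧
            VirtuallyAbelian ↥(Subgroup.normalClosure (K : Set (RandomMetabelian w))) ∧
            H ⊔ K = ⊤ ∧
            (∀ g : RandomMetabelian w,
              ∃ l ∈ Subgroup.normalClosure (K : Set (RandomMetabelian w)),
                ∃ h ∈ H, g = l * h)} : ℝ) /
        (Nat.card (Fin m → Fin ℓ → Fin n × Bool) : ℝ))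
      Filter.atTop (nhds 1) := by
  exact good_tendsto hn
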